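/- Let q, k be integers with q ≥ 2 and k > 3q² + 3q − 1, and set n = 2k + 5, a₃ = (q − 1)·C(n, k+3), a₄ = (q³ − 1)·C(n, k+4) − (k+2)·(q − 1)·C(n, k+3). Then there do not exist real numbers t₁, t₂ satisfying all four inequalities: t₁ ≥ 0; q·t₂ ≥ (k+4)·t₁; t₁·C(k+4, 2) + a₃/q^{k+1} ≥ q·t₂·(k+3−q); and q·t₂·(C(k+3, 2) − q·(k+2)) + a₄/q^{k+1} ≥ t₁·(C(k+4, 3) − q³). -/

import Mathlib

/-- The four linear constraints are inconsistent: a nonnegative combination of the first three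
contradicts the last. Here `m` is `k + 4`, and `S` is the common scale of the constant terms. -/
lemma linear_constraints_inconsistent {m q S x y c : ℝ} (hq : 2 ≤ q)
    (hm : 3 * q ^ 2 + 3 * q + 4 ≤ m) (hS : 0 < S)
    (hc : c * m = S * (m - 2) * (m - 1 - q - q ^ 2))
    (h₂ : m * x ≤ y)
    (h₃ : y * (m - 1 - q) ≤ x * (m * (m - 1) / 2) + S)
    (h₄ : x * (m * (m - 1) * (m - 2) / 6 - q ^ 3) ≤
      y * ((m - 1) * (m - 2) / 2 - q * (m - 2)) - c) : False := by
  have hm4 : 0 ≤ m - 1 - 4 * q := by nlinarith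
  have hm1 : 0 < m - 1 := by linarith
  have hm2 : 0 < m - 2 := by linarith
  have hm0 : 0 < m := by linarith
  have hq3 : 0 < q ^ 3 := by positivity
  have hD : 0 < m * (m - 1 - 2 * q) / 2 := by
    have : 0 < m - 1 - 2 * q := by linarith
    positivity
  have hw : 0 ≤ m * (m - 2) * ((m - 1) / 3 - q) + q ^ 3 := by
    have : 0 ≤ (m - 1) / 3 - q := by linarith
    positivity
  have hu : 0 ≤ m * (m - 1) * (m - 2) * ((m - 1 - 4 * q) / 12) + q ^ 3 * (m - 1 - q) := by
    have : 0 ≤ m - 1 - q := by linarith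
    positivity
  have hpos : 0 < m * (m - 1) * (m - 2)
      - 3 * (m - 2) * (1 + q + q ^ 2) * (m - 1 - 2 * q) - 6 * q ^ 3 := by
    have h1 : 0 ≤ (m - 2) * (m - 1 - 2 * q) * (m - 1 - 3 * (1 + q + q ^ 2)) :=
      mul_nonneg (mul_nonneg hm2.le (by linarith)) (by linarith)
    have h2 : 3 * q ^ 2 * (4 * q) ≤ (m - 2) * (m - 1) :=
      mul_le_mul (by nlinarith) (by linarith) (by positivity) hm2.le
    have h3 := mul_le_mul_of_nonneg_right h2 (by linarith : 0 ≤ 1 + 2 * q)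
    nlinarith [mul_pos hq3 (by linarith : 0 < q)]
  have e₂ := mul_nonneg hu (sub_nonneg.2 h₂)
  have e₃ := mul_nonneg hw (sub_nonneg.2 h₃)
  have e₄ := mul_nonneg hD.le (sub_nonneg.2 h₄)
  have e₅ := mul_pos hS hpos
  refine lt_irrefl (0 : ℝ) ?_
  linear_combination e₂ + e₃ + e₄ + e₅ / 6 - (m - 1 - 2 * q) / 2 * hc

/-- Claim III.2 of the paper (odd case `n = 2k+5`): for `q ≥ 2` and
`k > 3q² + 3q − 1`, with `a₃ = (q − 1)·C(n, k+3)` and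
`a₄ = (q³ − 1)·C(n, k+4) − (k+2)·(q − 1)·C(n, k+3)`, there are no reals
`t₁, t₂` satisfying the four displayed inequalities. -/
theorem stmt_8 (q k : ℕ) (hq : 2 ≤ q) (hk : k > 3 * q ^ 2 + 3 * q - 1)
    (n : ℕ) (hn : n = 2 * k + 5) (a₃ a₄ : ℝ)
    (ha₃ : a₃ = ((q : ℝ) - 1) * (n.choose (k + 3) : ℝ))
    (ha₄ : a₄ = ((q : ℝ) ^ 3 - 1) * (n.choose (k + 4) : ℝ)
      - (k + 2 : ℝ) * ((q : ℝ) - 1) * (n.choose (k + 3) : ℝ)) :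
    ¬ ∃ t₁ t₂ : ℝ, 0 ≤ t₁ ∧
      (k + 4 : ℝ) * t₁ ≤ (q : ℝ) * t₂ ∧
      (q : ℝ) * t₂ * ((k : ℝ) + 3 - (q : ℝ)) ≤
        t₁ * ((k + 4).choose 2 : ℝ) + a₃ / (q : ℝ) ^ (k + 1) ∧
      t₁ * (((k + 4).choose 3 : ℝ) - (q : ℝ) ^ 3) ≤
        (q : ℝ) * t₂ * (((k + 3).choose 2 : ℝ) - (q : ℝ) * (k + 2 : ℝ)) + a₄ / (q : ℝ) ^ (k + 1) := by
  rintro ⟨t₁, t₂, -, h₂, h₃, h₄⟩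
  have hk' : 3 * q ^ 2 + 3 * q ≤ k := by omega
  have hkR : 3 * (q : ℝ) ^ 2 + 3 * q ≤ k := by exact_mod_cast hk'
  have hqR : (2 : ℝ) ≤ q := by exact_mod_cast hq
  have hA : (0 : ℝ) < n.choose (k + 3) := by
    exact_mod_cast Nat.choose_pos (by omega : k + 3 ≤ n)
  have hchoose : (n.choose (k + 4) : ℝ) * (k + 4) = n.choose (k + 3) * (k + 2) := by
    have h := Nat.choose_succ_right_eq n (k + 3)
    rw [show n - (k + 3) = k + 2 by omega] at h
    exact_mod_cast h
  have hc3 : ((k + 4).choose 3 : ℝ) = ((k : ℝ) + 4) * (k + 3) * (k + 2) / 6 := by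
    have h := Nat.choose_succ_right_eq (k + 4) 2
    rw [show k + 4 - 2 = k + 2 by omega] at h
    have hR : ((k + 4).choose 3 : ℝ) * 3 = (k + 4).choose 2 * (k + 2) := by exact_mod_cast h
    rw [Nat.cast_choose_two] at hR
    push_cast at hR
    linear_combination hR / 3
  have hp : (0 : ℝ) < (q : ℝ) ^ (k + 1) := by positivity
  rw [Nat.cast_choose_two] at h₃ h₄
  rw [hc3] at h₄
  push_cast at h₃ h₄
  refine linear_constraints_inconsistent (m := (k : ℝ) + 4) (q := q)
    (S := a₃ / (q : ℝ) ^ (k + 1)) (x := t₁) (y := q * t₂) (c := -(a₄ / (q : ℝ) ^ (k + 1)))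
    hqR (by linarith) ?_ ?_ h₂ (by linear_combination h₃) (by linear_combination h₄)
  · rw [ha₃]
    exact div_pos (mul_pos (by linarith) hA) hp
  · rw [ha₃, ha₄]
    field_simp
    linear_combination (1 - (q : ℝ) ^ 3) * hchoose
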